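/- arXiv:1304.6683 — 5 statements merged into one kernel-verified Lean document; each statement's English description precedes it below -/
import Mathlib

section
/- Let (Ω, 𝓕, P) be a probability space and T > 0. For each n ∈ ℕ let V_n : Ω × [0,T] → ℝ be such that V_n(·,t) is measurable for each t and, for every ω, the map t ↦ V_n(ω,t) is nondecreasing with V_n(ω,0) ≥ 0. Let v : Ω × [0,T] → ℝ be such that v(·,t) is measurable for each t and, for P-almost every ω, the map t ↦ v(ω,t) is continuous and nondecreasing with v(ω,0) = 0 and v(ω,T) > 0. Assume that for each t ∈ [0,T], V_n(·,t) → v(·,t) in probability as n → ∞ (convergence in measure with respect to P). Then sup_{t ∈ [0,T]} |V_n(·,t)/V_n(·,T) − v(·,t)/v(·,T)| → 0 in probability as n → ∞, where division by zero is interpreted as zero. -/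
open MeasureTheory Filter Set

/-- The ratio of two sequences converging in measure converges in measure, provided the limit of
the denominators is almost everywhere nonzero. -/
theorem MeasureTheory.TendstoInMeasure.div_of_ae_ne_zero {Ω : Type*} [MeasurableSpace Ω]
    {P : Measure Ω} [IsFiniteMeasure P] {X Y : ℕ → Ω → ℝ} {x y : Ω → ℝ}
    (hXm : ∀ n, Measurable (X n)) (hYm : ∀ n, Measurable (Y n))
    (hX : TendstoInMeasure P X atTop x) (hY : TendstoInMeasure P Y atTop y)
    (hy : ∀ᵐ ω ∂P, y ω ≠ 0) :
    TendstoInMeasure P (fun n ω => X n ω / Y n ω) atTop (fun ω => x ω / y ω) := by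
  refine (exists_seq_tendstoInMeasure_atTop_iff
    (fun n => ((hXm n).div (hYm n)).aestronglyMeasurable)).2 ?_
  intro ns hns
  obtain ⟨ms, hms, hX'⟩ := (hX.comp hns.tendsto_atTop).exists_seq_tendsto_ae
  obtain ⟨ks, hks, hY'⟩ :=
    (hY.comp (hns.tendsto_atTop.comp hms.tendsto_atTop)).exists_seq_tendsto_ae
  refine ⟨ms ∘ ks, hms.comp hks, ?_⟩
  filter_upwards [hX', hY', hy] with ω h1 h2 h3
  exact (h1.comp hks.tendsto_atTop).div h2 h3

/-- The nodes of the uniform grid with `K + 1` cells lie in the interval. -/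
theorem grid_node_mem_Icc {T : ℝ} (hT : 0 ≤ T) {K i : ℕ} (hi : i ≤ K + 1) :
    T * (i / (K + 1 : ℝ)) ∈ Icc 0 T := by
  refine ⟨by positivity, mul_le_of_le_one_right hT ?_⟩
  rw [div_le_one (by positivity)]
  exact_mod_cast hi

/-- Two monotone functions that are `a`-close on a uniform grid, on whose cells the second one
grows by at most `b`, are `(a + b)`-close everywhere. -/
theorem MonotoneOn.abs_sub_le_of_grid {T a b : ℝ} (hT : 0 < T) {f g : ℝ → ℝ}
    (hf : MonotoneOn f (Icc 0 T)) (hg : MonotoneOn g (Icc 0 T)) (K : ℕ)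
    (hfg : ∀ i ∈ Finset.range (K + 2),
      |f (T * (i / (K + 1 : ℝ))) - g (T * (i / (K + 1 : ℝ)))| ≤ a)
    (hgb : ∀ i ∈ Finset.range (K + 1),
      g (T * ((i + 1 : ℕ) / (K + 1 : ℝ))) - g (T * (i / (K + 1 : ℝ))) ≤ b)
    {t : ℝ} (ht : t ∈ Icc 0 T) : |f t - g t| ≤ a + b := by
  have hK : (0 : ℝ) < K + 1 := by positivity
  obtain ⟨i, hi, hti, hti'⟩ : ∃ i : ℕ, i < K + 1 ∧ T * (i / (K + 1 : ℝ)) ≤ t ∧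
      t ≤ T * ((i + 1 : ℕ) / (K + 1 : ℝ)) := by
    rcases ht.2.eq_or_lt with rfl | htT
    · refine ⟨K, Nat.lt_succ_self K, (grid_node_mem_Icc hT.le (Nat.le_succ K)).2, ?_⟩
      push_cast
      rw [div_self hK.ne', mul_one]
    · have hs : 0 ≤ t * (K + 1) / T := div_nonneg (mul_nonneg ht.1 hK.le) hT.le
      refine ⟨⌊t * (K + 1) / T⌋₊, ?_, ?_, ?_⟩
      · rw [Nat.floor_lt hs, div_lt_iff₀ hT]
        push_cast
        nlinarith
      · have h := Nat.floor_le hs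
        rw [le_div_iff₀ hT] at h
        rw [← mul_div_assoc, div_le_iff₀ hK]
        linarith
      · have h := (Nat.lt_floor_add_one (t * (K + 1) / T)).le
        rw [div_le_iff₀ hT] at h
        rw [← mul_div_assoc, le_div_iff₀ hK]
        push_cast
        linarith
  have hm := grid_node_mem_Icc hT.le hi.le
  have hm' := grid_node_mem_Icc hT.le hi
  have h1 := abs_le.1 (hfg i (by simp; omega))
  have h2 := abs_le.1 (hfg (i + 1) (by simp; omega))
  have h3 := hgb i (by simpa using hi)
  have h4 := hf hm ht hti
  have h5 := hf ht hm' hti'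
  have h6 := hg hm ht hti
  have h7 := hg ht hm' hti'
  rw [abs_le]
  constructor <;> linarith [h1.1, h2.2]

/-- The increments of a continuous function over the cells of a uniform grid are eventually
uniformly small. -/
theorem ContinuousOn.eventually_grid_increment_lt {T ε : ℝ} (hT : 0 < T) (hε : 0 < ε) {g : ℝ → ℝ}
    (hg : ContinuousOn g (Icc 0 T)) :
    ∀ᶠ K : ℕ in atTop, ∀ i ∈ Finset.range (K + 1),
      g (T * ((i + 1 : ℕ) / (K + 1 : ℝ))) - g (T * (i / (K + 1 : ℝ))) < ε := by
  obtain ⟨δ, hδ, h⟩ := Metric.uniformContinuousOn_iff.1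
    (isCompact_Icc.uniformContinuousOn_of_continuous hg) ε hε
  have hlim : Tendsto (fun K : ℕ => T * (1 / ((K : ℝ) + 1))) atTop (nhds 0) := by
    simpa using tendsto_one_div_add_atTop_nhds_zero_nat.const_mul T
  filter_upwards [hlim.eventually (gt_mem_nhds hδ)] with K hKδ i hi
  have hK : (0 : ℝ) < K + 1 := by positivity
  have hi' : i < K + 1 := by simpa using hi
  refine (le_abs_self _).trans_lt (h _ (grid_node_mem_Icc hT.le hi') _ (grid_node_mem_Icc hT.le hi'.le) ?_)
  have heq : T * ((i + 1 : ℕ) / (K + 1 : ℝ)) - T * (i / (K + 1 : ℝ)) = T * (1 / ((K : ℝ) + 1)) := by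
    push_cast
    ring
  rw [Real.dist_eq, heq, abs_of_pos (by positivity)]
  exact hKδ

theorem relative_power_variation_consistency
    {Ω : Type*} [MeasurableSpace Ω] (P : Measure Ω) [IsProbabilityMeasure P]
    (T : ℝ) (hT : 0 < T)
    (V : ℕ → Ω → ℝ → ℝ) (v : Ω → ℝ → ℝ)
    (hVmeas : ∀ n : ℕ, ∀ t ∈ Set.Icc (0:ℝ) T, Measurable (fun ω => V n ω t))
    (hVmono : ∀ n : ℕ, ∀ ω : Ω, MonotoneOn (V n ω) (Set.Icc 0 T))
    (hV0 : ∀ n : ℕ, ∀ ω : Ω, 0 ≤ V n ω 0)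
    (hvmeas : ∀ t ∈ Set.Icc (0:ℝ) T, Measurable (fun ω => v ω t))
    (hv_ae : ∀ᵐ ω ∂P, ContinuousOn (v ω) (Set.Icc 0 T) ∧ MonotoneOn (v ω) (Set.Icc 0 T)
      ∧ v ω 0 = 0 ∧ 0 < v ω T)
    (hconv : ∀ t ∈ Set.Icc (0:ℝ) T,
      TendstoInMeasure P (fun n ω => V n ω t) atTop (fun ω => v ω t)) :
    TendstoInMeasure P
      (fun n ω => ⨆ t : Set.Icc (0:ℝ) T, |V n ω t / V n ω T - v ω t / v ω T|)
      atTop (fun _ => (0:ℝ)) := by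
  have hT0 : (0 : ℝ) ∈ Icc 0 T := ⟨le_rfl, hT.le⟩
  have hTT : T ∈ Icc 0 T := ⟨hT.le, le_rfl⟩
  have hratio : ∀ t ∈ Icc (0 : ℝ) T, TendstoInMeasure P (fun n ω => V n ω t / V n ω T) atTop
      (fun ω => v ω t / v ω T) := fun t ht =>
    (hconv t ht).div_of_ae_ne_zero (fun n => hVmeas n t ht) (fun n => hVmeas n T hTT)
      (hconv T hTT) (hv_ae.mono fun ω h => h.2.2.2.ne')
  rw [tendstoInMeasure_iff_norm]
  intro ε hε
  set E : ℕ → Set Ω := fun K => ⋃ i ∈ Finset.range (K + 1),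
    {ω | ε / 4 ≤ v ω (T * ((i + 1 : ℕ) / (K + 1 : ℝ))) / v ω T
      - v ω (T * (i / (K + 1 : ℝ))) / v ω T} with hE
  have hEmeas : ∀ K, MeasurableSet (E K) := by
    intro K
    refine Finset.measurableSet_biUnion _ fun i hi => measurableSet_le measurable_const ?_
    have hi' : i < K + 1 := by simpa using hi
    exact ((hvmeas _ (grid_node_mem_Icc hT.le hi')).div (hvmeas T hTT)).sub
      ((hvmeas _ (grid_node_mem_Icc hT.le hi'.le)).div (hvmeas T hTT))
  have hElim : Tendsto (fun K => P (E K)) atTop (nhds 0) := by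
    have h := tendsto_measure_of_ae_tendsto_indicator_of_isFiniteMeasure atTop (μ := P)
      (A := ∅) (As := E) MeasurableSet.empty hEmeas ?_
    · simpa using h
    filter_upwards [hv_ae] with ω hω
    filter_upwards [(hω.1.div_const (v ω T)).eventually_grid_increment_lt hT
      (by positivity : 0 < ε / 4)] with K hK
    simp only [hE, mem_iUnion, mem_ofPred_eq, mem_empty_iff_false, iff_false, not_exists, not_le]
    exact hK
  have hbound : ∀ K n, P {ω | ε ≤ ‖(⨆ t : Icc (0:ℝ) T, |V n ω t / V n ω T - v ω t / v ω T|) - 0‖}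
      ≤ (∑ i ∈ Finset.range (K + 2), P {ω | ε / 2 ≤ ‖V n ω (T * (i / (K + 1 : ℝ))) / V n ω T
        - v ω (T * (i / (K + 1 : ℝ))) / v ω T‖}) + P (E K) := by
    intro K n
    refine (measure_mono_ae ?_).trans ((measure_union_le _ _).trans
      (add_le_add_left (measure_biUnion_finset_le _ _) _))
    filter_upwards [hv_ae] with ω hω hmemω
    by_contra hnot
    have hnot' := not_or.1 hnot
    have hnot1 : ∀ i ∈ Finset.range (K + 2), |V n ω (T * (i / (K + 1 : ℝ))) / V n ω T
        - v ω (T * (i / (K + 1 : ℝ))) / v ω T| ≤ ε / 2 := by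
      intro i hi
      by_contra hlt
      exact hnot'.1 (mem_biUnion (Finset.mem_coe.2 hi) (not_le.1 hlt).le)
    have hnot2 : ∀ i ∈ Finset.range (K + 1), v ω (T * ((i + 1 : ℕ) / (K + 1 : ℝ))) / v ω T
        - v ω (T * (i / (K + 1 : ℝ))) / v ω T ≤ ε / 4 := by
      intro i hi
      by_contra hlt
      exact hnot'.2 (mem_biUnion (Finset.mem_coe.2 hi) (not_le.1 hlt).le)
    have hVT : 0 ≤ V n ω T := (hV0 n ω).trans (hVmono n ω hT0 hTT hT.le)
    have hclose : ∀ t : Icc (0:ℝ) T, |V n ω t / V n ω T - v ω t / v ω T| ≤ ε / 2 + ε / 4 :=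
      fun t => MonotoneOn.abs_sub_le_of_grid hT (f := fun t => V n ω t / V n ω T)
        (g := fun t => v ω t / v ω T)
        (fun s hs u hu hsu => div_le_div_of_nonneg_right (hVmono n ω hs hu hsu) hVT)
        (fun s hs u hu hsu => div_le_div_of_nonneg_right (hω.2.1 hs hu hsu) hω.2.2.2.le)
        K hnot1 hnot2 t.2
    have hsup := Real.iSup_le hclose (by positivity)
    have hsup0 := Real.iSup_nonneg fun t : Icc (0:ℝ) T =>
      abs_nonneg (V n ω t / V n ω T - v ω t / v ω T)
    have hge : ε ≤ ‖(⨆ t : Icc (0:ℝ) T, |V n ω t / V n ω T - v ω t / v ω T|) - 0‖ := hmemω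
    rw [sub_zero, Real.norm_of_nonneg hsup0] at hge
    linarith
  refine ENNReal.tendsto_nhds_zero.2 fun δ hδ => ?_
  obtain ⟨K, hK⟩ := (hElim.eventually (gt_mem_nhds hδ)).exists
  have hsum : Tendsto (fun n => (∑ i ∈ Finset.range (K + 2),
      P {ω | ε / 2 ≤ ‖V n ω (T * (i / (K + 1 : ℝ))) / V n ω T
        - v ω (T * (i / (K + 1 : ℝ))) / v ω T‖}) + P (E K)) atTop (nhds (0 + P (E K))) := by
    refine Tendsto.add_const _ ?_
    have hzero : ∑ _i ∈ Finset.range (K + 2), (0 : ENNReal) = 0 := Finset.sum_const_zero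
    refine Eq.subst (motive := fun c => Tendsto _ _ (nhds c)) hzero
      (tendsto_finsetSum _ fun i hi => ?_)
    have hi' : i < K + 2 := by simpa using hi
    exact tendstoInMeasure_iff_norm.1 (hratio _ (grid_node_mem_Icc hT.le (by omega))) (ε / 2) (by positivity)
  rw [zero_add] at hsum
  filter_upwards [hsum.eventually (gt_mem_nhds hK)] with n hn
  exact (hbound K n).trans hn.le
end

section
/- Let T > 0 and let y : [0,T] → ℝ be continuously differentiable with ∫_0^T y'(s)² ds > 0. Then for all 0 ≤ t ≤ t + u ≤ T, the realised relative energy dissipation R_δ⁺(t, t+u) = [y_δ]_{t+u}/[y_δ]_T − [y_δ]_t/[y_δ]_T converges, as δ → 0⁺, to (ε⁺(t+u) − ε⁺(t))/ε⁺(T), the relative energy dissipation of y over [t, t+u]. -/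
open Set Filter MeasureTheory

/-- The squared increment of `y` over a short interval is close to its length times the integral of
the squared derivative. -/
lemma abs_sq_increment_sub_integral_le {y g : ℝ → ℝ} {a b ε : ℝ} (hab : a < b)
    (hyc : ContinuousOn y (Icc a b))
    (hderiv : ∀ x ∈ Ioo a b, HasDerivAt y (g x) x)
    (hg : ContinuousOn g (Icc a b))
    (hosc : ∀ x ∈ Icc a b, ∀ z ∈ Icc a b, |g x ^ 2 - g z ^ 2| ≤ ε) :
    |(y b - y a) ^ 2 - (b - a) * ∫ s in a..b, g s ^ 2| ≤ (b - a) * (ε * (b - a)) := by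
  obtain ⟨c, hc, hcd⟩ := exists_hasDerivAt_eq_slope y g hab hyc hderiv
  have hba : 0 < b - a := sub_pos.2 hab
  have hint : IntervalIntegrable (fun s => g s ^ 2) volume a b :=
    ((hg.pow 2).mono (by rw [uIcc_of_le hab.le])).intervalIntegrable
  have hincr : (y b - y a) ^ 2 = (b - a) * ∫ _ in a..b, g c ^ 2 := by
    rw [intervalIntegral.integral_const, smul_eq_mul, hcd]
    field_simp
  rw [hincr, ← mul_sub, ← intervalIntegral.integral_sub intervalIntegrable_const hint, abs_mul,
    abs_of_pos hba]
  refine mul_le_mul_of_nonneg_left ?_ hba.le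
  have hbound := intervalIntegral.norm_integral_le_of_norm_le_const (a := a) (b := b) (C := ε)
    (f := fun s => g c ^ 2 - g s ^ 2) (fun x hx => by
      rw [uIoc_of_le hab.le] at hx
      exact hosc c (Ioo_subset_Icc_self hc) x (Ioc_subset_Icc_self hx))
  rwa [abs_of_pos hba, Real.norm_eq_abs] at hbound

/-- The realised quadratic variation over `n` steps of size `δ` is close to `δ` times the integral
of the squared derivative. -/
lemma abs_sum_sq_increment_sub_integral_le {y g : ℝ → ℝ} {T δ ε : ℝ} (hδ : 0 < δ)
    (hyc : ContinuousOn y (Icc 0 T))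
    (hderiv : ∀ x ∈ Ioo 0 T, HasDerivAt y (g x) x)
    (hg : ContinuousOn g (Icc 0 T))
    (hosc : ∀ x ∈ Icc 0 T, ∀ z ∈ Icc 0 T, |x - z| ≤ δ → |g x ^ 2 - g z ^ 2| ≤ ε)
    (n : ℕ) (hn : n * δ ≤ T) :
    |∑ j ∈ Finset.Icc 1 n, (y ((j : ℝ) * δ) - y (((j : ℝ) - 1) * δ)) ^ 2 -
      δ * ∫ s in (0 : ℝ)..(n * δ), g s ^ 2| ≤ δ * (ε * (n * δ)) := by
  induction n with
  | zero => simp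
  | succ n ih =>
    push_cast at hn ⊢
    have hn0 : 0 ≤ (n : ℝ) * δ := by positivity
    have hlt : (n : ℝ) * δ < (n + 1) * δ := by nlinarith
    have hsub : Icc ((n : ℝ) * δ) ((n + 1) * δ) ⊆ Icc 0 T := Icc_subset_Icc hn0 hn
    have hlen : ((n : ℝ) + 1) * δ - n * δ = δ := by ring
    have hstep := abs_sq_increment_sub_integral_le (ε := ε) hlt (hyc.mono hsub)
      (fun x hx => hderiv x (Ioo_subset_Ioo hn0 hn hx)) (hg.mono hsub)
      (fun x hx z hz => hosc x (hsub hx) z (hsub hz) (by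
        rw [← hlen]; exact abs_sub_le_of_le_of_le hx.1 hx.2 hz.1 hz.2))
    rw [hlen] at hstep
    have hint : ∀ {a b : ℝ}, 0 ≤ a → a ≤ b → b ≤ T →
        IntervalIntegrable (fun s => g s ^ 2) volume a b := fun ha hab hb =>
      ((hg.pow 2).mono (by
        rw [uIcc_of_le hab]; exact Icc_subset_Icc ha hb)).intervalIntegrable
    rw [Finset.sum_Icc_succ_top (by omega), ← intervalIntegral.integral_add_adjacent_intervals
      (hint le_rfl hn0 (hlt.le.trans hn)) (hint hn0 hlt.le hn)]
    push_cast
    rw [add_sub_cancel_right]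
    have hsum := (abs_add_le _ _).trans (add_le_add (ih (hlt.le.trans hn)) hstep)
    calc _ = _ := by congr 1; ring
      _ ≤ _ := hsum
      _ = _ := by ring

lemma tendsto_natFloor_div_mul_nhdsGT_zero {t : ℝ} (ht : 0 ≤ t) :
    Tendsto (fun δ : ℝ => (⌊t / δ⌋₊ : ℝ) * δ) (nhdsWithin 0 (Ioi 0)) (nhds t) := by
  have hlow : Tendsto (fun δ : ℝ => t - δ) (nhdsWithin 0 (Ioi 0)) (nhds t) := by
    have : Tendsto (fun δ : ℝ => t - δ) (nhds 0) (nhds (t - 0)) :=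
      (continuous_const.sub continuous_id).tendsto 0
    rw [sub_zero] at this
    exact this.mono_left nhdsWithin_le_nhds
  refine tendsto_of_tendsto_of_tendsto_of_le_of_le' hlow tendsto_const_nhds ?_ ?_
  · filter_upwards [self_mem_nhdsWithin] with δ hδ
    have hδ : 0 < δ := hδ
    have := (div_lt_iff₀ hδ).1 (Nat.lt_floor_add_one (t / δ))
    linarith
  · filter_upwards [self_mem_nhdsWithin] with δ hδ
    have hδ : 0 < δ := hδ
    exact (le_div_iff₀ hδ).1 (Nat.floor_le (by positivity))

/-- The rescaled realised quadratic variation of a `C¹` function converges to the integral of its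
squared derivative. -/
lemma tendsto_sum_sq_increment_div {y g : ℝ → ℝ} {T t : ℝ}
    (hyc : ContinuousOn y (Icc 0 T))
    (hderiv : ∀ x ∈ Ioo 0 T, HasDerivAt y (g x) x)
    (hg : ContinuousOn g (Icc 0 T)) (ht : 0 ≤ t) (htT : t ≤ T) :
    Tendsto (fun δ : ℝ => (∑ j ∈ Finset.Icc 1 ⌊t / δ⌋₊,
        (y ((j : ℝ) * δ) - y (((j : ℝ) - 1) * δ)) ^ 2) / δ)
      (nhdsWithin 0 (Ioi 0)) (nhds (∫ s in (0 : ℝ)..t, g s ^ 2)) := by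
  have hT : 0 ≤ T := ht.trans htT
  have hfloor := tendsto_natFloor_div_mul_nhdsGT_zero ht
  have hmem : ∀ᶠ δ : ℝ in nhdsWithin 0 (Ioi 0), (⌊t / δ⌋₊ : ℝ) * δ ∈ Icc 0 t := by
    filter_upwards [self_mem_nhdsWithin] with δ hδ
    have hδ : 0 < δ := hδ
    exact ⟨by positivity, (le_div_iff₀ hδ).1 (Nat.floor_le (by positivity))⟩
  have hprim : Tendsto (fun δ : ℝ => ∫ s in (0 : ℝ)..((⌊t / δ⌋₊ : ℝ) * δ), g s ^ 2)
      (nhdsWithin 0 (Ioi 0)) (nhds (∫ s in (0 : ℝ)..t, g s ^ 2)) := by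
    have hcont : ContinuousOn (fun x => ∫ s in (0 : ℝ)..x, g s ^ 2) (Icc 0 t) := by
      have := intervalIntegral.continuousOn_primitive_interval (μ := volume) (a := 0) (b := t)
        (f := fun s => g s ^ 2) (by
          rw [uIcc_of_le ht]
          exact ((hg.pow 2).mono (Icc_subset_Icc_right htT)).integrableOn_Icc)
      rwa [uIcc_of_le ht] at this
    exact (hcont t (right_mem_Icc.2 ht)).tendsto.comp
      (tendsto_nhdsWithin_iff.2 ⟨hfloor, hmem⟩)
  refine hprim.congr_dist (Metric.tendsto_nhds.2 fun ε hε => ?_)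
  have hunif := isCompact_Icc.uniformContinuousOn_of_continuous (hg.pow 2)
  obtain ⟨η, hη, hosc⟩ := Metric.uniformContinuousOn_iff.1 hunif (ε / (T + 1)) (by positivity)
  filter_upwards [self_mem_nhdsWithin, hmem,
    nhdsWithin_le_nhds (gt_mem_nhds hη)] with δ hδ hδt hδη
  have hδ : 0 < δ := hδ
  have hbound := abs_sum_sq_increment_sub_integral_le hδ hyc hderiv hg
    (fun x hx z hz hxz => (hosc x hx z hz (hxz.trans_lt hδη)).le) ⌊t / δ⌋₊ (hδt.2.trans htT)
  rw [dist_zero_right, Real.norm_eq_abs, abs_of_nonneg dist_nonneg, dist_comm, Real.dist_eq]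
  have hscale : ∀ S I : ℝ, S / δ - I = (S - δ * I) / δ := fun S I => by field_simp
  rw [hscale, abs_div, abs_of_pos hδ, div_lt_iff₀ hδ]
  refine hbound.trans_lt ?_
  rw [mul_comm]
  refine mul_lt_mul_of_pos_right ?_ hδ
  rw [div_mul_eq_mul_div, div_lt_iff₀ (by positivity)]
  exact mul_lt_mul_of_pos_left (by linarith [hδt.2]) hε

open Set Filter MeasureTheory

theorem realised_relative_energy_dissipation_classical (T : ℝ) (hT : 0 < T) (y : ℝ → ℝ)
    (hy : ContDiffOn ℝ 1 y (Set.Icc 0 T))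
    (hpos : 0 < ∫ s in (0:ℝ)..T, (derivWithin y (Set.Icc 0 T) s)^2) :
    ∀ t u : ℝ, 0 ≤ t → 0 ≤ u → t + u ≤ T →
      Tendsto
        (fun δ : ℝ =>
          (∑ j ∈ Finset.Icc 1 ⌊(t+u)/δ⌋₊, (y ((j:ℝ)*δ) - y (((j:ℝ)-1)*δ))^2) /
            (∑ j ∈ Finset.Icc 1 ⌊T/δ⌋₊, (y ((j:ℝ)*δ) - y (((j:ℝ)-1)*δ))^2) -
          (∑ j ∈ Finset.Icc 1 ⌊t/δ⌋₊, (y ((j:ℝ)*δ) - y (((j:ℝ)-1)*δ))^2) /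
            (∑ j ∈ Finset.Icc 1 ⌊T/δ⌋₊, (y ((j:ℝ)*δ) - y (((j:ℝ)-1)*δ))^2))
        (nhdsWithin 0 (Set.Ioi 0))
        (nhds (((∫ s in (0:ℝ)..(t+u), (derivWithin y (Set.Icc 0 T) s)^2) -
            (∫ s in (0:ℝ)..t, (derivWithin y (Set.Icc 0 T) s)^2)) /
          (∫ s in (0:ℝ)..T, (derivWithin y (Set.Icc 0 T) s)^2))) := by
  intro t u ht hu htu
  have hderiv : ∀ x ∈ Ioo 0 T, HasDerivAt y (derivWithin y (Icc 0 T) x) x := fun x hx =>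
    ((hy.differentiableOn (by norm_num) x (Ioo_subset_Icc_self hx)).hasDerivWithinAt).hasDerivAt
      (Icc_mem_nhds hx.1 hx.2)
  have hg : ContinuousOn (derivWithin y (Icc 0 T)) (Icc 0 T) :=
    hy.continuousOn_derivWithin (uniqueDiffOn_Icc hT) le_rfl
  have hlim : ∀ r : ℝ, 0 ≤ r → r ≤ T → _ := fun r hr hrT =>
    tendsto_sum_sq_increment_div hy.continuousOn hderiv hg hr hrT
  have hT_lim := hlim T hT.le le_rfl
  have hmain := ((hlim (t + u) (by linarith) htu).div hT_lim hpos.ne').sub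
    ((hlim t ht (by linarith)).div hT_lim hpos.ne')
  rw [← sub_div] at hmain
  refine hmain.congr' ?_
  filter_upwards [self_mem_nhdsWithin] with δ hδ
  have hδ : δ ≠ 0 := (show (0 : ℝ) < δ from hδ).ne'
  simp only [Pi.div_apply, div_div_div_cancel_right₀ hδ]
end

section
/- For every integer l ≥ 2, the series Σ_{j=1}^∞ ρ_ν(j)^l converges for each ν ∈ (1/2, 1), and the map ν ↦ Σ_{j=1}^∞ ρ_ν(j)^l is continuous on (1/2, 1). -/
/-- The autocorrelation function of fractional Gaussian noise with Hurst parameter `ν - 1/2`: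
`ρ_ν(j) = (1/2)((j+1)^{2ν-1} - 2 j^{2ν-1} + (j-1)^{2ν-1})`, using real powers
(note `(0:ℝ) ^ (2ν-1) = 0` for `ν ∈ (1/2,1)` since the exponent is nonzero). -/
noncomputable def rho (ν : ℝ) (j : ℕ) : ℝ :=
  (1/2) * (((j:ℝ) + 1) ^ (2*ν - 1) - 2 * (j:ℝ) ^ (2*ν - 1) + ((j:ℝ) - 1) ^ (2*ν - 1))

/-- Tangent-line bound at `x` for the concave function `x ↦ x ^ a`. -/
theorem add_rpow_le_tangent {a x t : ℝ} (ha : 0 ≤ a) (ha1 : a ≤ 1) (hx : 0 < x)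
    (hxt : 0 ≤ x + t) : (x + t) ^ a ≤ x ^ a + a * t * (x ^ a / x) := by
  have ht : -1 ≤ t / x := by
    rw [le_div_iff₀ hx]
    linarith
  have hfactor : x + t = x * (1 + t / x) := by field_simp
  rw [hfactor, Real.mul_rpow hx.le (by linarith)]
  have hb := mul_le_mul_of_nonneg_left (rpow_one_add_le_one_add_mul_self ht ha ha1)
    (Real.rpow_nonneg hx.le a)
  calc x ^ a * (1 + t / x) ^ a ≤ x ^ a * (1 + a * (t / x)) := hb
    _ = x ^ a + a * t * (x ^ a / x) := by ring

theorem second_difference_rpow_nonpos {a x : ℝ} (ha : 0 ≤ a) (ha1 : a ≤ 1) (hx : 1 ≤ x) :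
    (x + 1) ^ a - 2 * x ^ a + (x - 1) ^ a ≤ 0 := by
  have hright := add_rpow_le_tangent (t := 1) ha ha1 (by linarith : 0 < x) (by linarith)
  have hleft := add_rpow_le_tangent (t := -1) ha ha1 (by linarith : 0 < x) (by linarith)
  rw [← sub_eq_add_neg] at hleft
  linarith

theorem neg_two_div_le_second_difference_rpow {a x : ℝ} (ha : 0 ≤ a) (ha1 : a ≤ 1)
    (hx : 2 ≤ x) : -(2 / (x + 1)) ≤ (x + 1) ^ a - 2 * x ^ a + (x - 1) ^ a := by
  have hleft := add_rpow_le_tangent (x := x - 1) (t := 1) ha ha1 (by linarith) (by linarith)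
  have hright := add_rpow_le_tangent (x := x + 1) (t := -1) ha ha1 (by linarith) (by linarith)
  rw [sub_add_cancel] at hleft
  rw [← sub_eq_add_neg, add_sub_cancel_right] at hright
  have hmono : (x - 1) ^ a ≤ (x + 1) ^ a :=
    Real.rpow_le_rpow (by linarith) (by linarith) ha
  have hle : (x - 1) ^ a ≤ x - 1 := by
    simpa using Real.rpow_le_rpow_of_exponent_le (by linarith : 1 ≤ x - 1) ha1
  have hpos : 0 < x - 1 := by linarith
  have hpos' : 0 < x + 1 := by linarith
  have hdiff : (x - 1) ^ a / (x - 1) - (x + 1) ^ a / (x + 1) ≤ 2 / (x + 1) := by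
    have hdiv : (x - 1) ^ a / (x + 1) ≤ (x + 1) ^ a / (x + 1) := by gcongr
    have hratio : (x - 1) ^ a / (x - 1) ≤ 1 := (div_le_one hpos).2 hle
    have hsplit : (x - 1) ^ a / (x - 1) - (x - 1) ^ a / (x + 1)
        = (x - 1) ^ a / (x - 1) * (2 / (x + 1)) := by
      field_simp
      ring
    have hmul := mul_le_mul_of_nonneg_right hratio (by positivity : 0 ≤ 2 / (x + 1))
    linarith
  have hscale : a * ((x - 1) ^ a / (x - 1) - (x + 1) ^ a / (x + 1)) ≤ 2 / (x + 1) :=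
    (mul_le_mul_of_nonneg_left hdiff ha).trans
      (mul_le_of_le_one_left (by positivity) ha1)
  linarith

/-- A bound on the autocorrelations that is uniform in the Hurst parameter. -/
theorem abs_rho_succ_le {ν : ℝ} (hν : ν ∈ Set.Ioo (1 / 2 : ℝ) 1) (j : ℕ) :
    |rho ν (j + 1)| ≤ 1 / ((j + 1 : ℕ) : ℝ) := by
  obtain ⟨hν₀, hν₁⟩ := hν
  have ha : 0 < 2 * ν - 1 := by linarith
  have ha1 : 2 * ν - 1 ≤ 1 := by linarith
  have hone : (1 : ℝ) ≤ ((j + 1 : ℕ) : ℝ) := by exact_mod_cast Nat.le_add_left 1 j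
  have hup := second_difference_rpow_nonpos ha.le ha1 hone
  have hlow : -(2 / ((j + 1 : ℕ) : ℝ)) ≤ (((j + 1 : ℕ) : ℝ) + 1) ^ (2 * ν - 1)
      - 2 * ((j + 1 : ℕ) : ℝ) ^ (2 * ν - 1) + (((j + 1 : ℕ) : ℝ) - 1) ^ (2 * ν - 1) := by
    rcases j.eq_zero_or_pos with rfl | hj
    · have htwo : (0 : ℝ) ≤ (1 + 1) ^ (2 * ν - 1) := by positivity
      simp only [zero_add, Nat.cast_one, Real.one_rpow, sub_self, Real.zero_rpow ha.ne']
      generalize ((1 : ℝ) + 1) ^ (2 * ν - 1) = y at htwo ⊢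
      linarith
    · have htwo : (2 : ℝ) ≤ ((j + 1 : ℕ) : ℝ) := by exact_mod_cast Nat.succ_le_succ hj
      refine le_trans ?_ (neg_two_div_le_second_difference_rpow ha.le ha1 htwo)
      gcongr
      linarith
  have hhalf : 2 / ((j + 1 : ℕ) : ℝ) = 2 * (1 / ((j + 1 : ℕ) : ℝ)) := by ring
  rw [hhalf] at hlow
  have hnonneg : 0 ≤ 1 / ((j + 1 : ℕ) : ℝ) := by positivity
  unfold rho
  rw [abs_le]
  constructor <;> linarith

theorem continuousOn_rho_succ (j : ℕ) :
    ContinuousOn (fun ν : ℝ => rho ν (j + 1)) (Set.Ioo (1 / 2) 1) := by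
  have hpow (x : ℝ) :
      ContinuousOn (fun ν : ℝ => x ^ (2 * ν - 1)) (Set.Ioo (1 / 2) 1) :=
    continuousOn_const.rpow (by fun_prop) fun ν hν => Or.inr (by linarith [hν.1])
  unfold rho
  exact continuousOn_const.mul
    (((hpow _).sub (continuousOn_const.mul (hpow _))).add (hpow _))

theorem rho_power_series_continuous (l : ℕ) (hl : 2 ≤ l) :
    (∀ ν ∈ Set.Ioo (1/2 : ℝ) 1, Summable (fun j : ℕ => rho ν (j+1) ^ l)) ∧
      ContinuousOn (fun ν : ℝ => ∑' j : ℕ, rho ν (j+1) ^ l) (Set.Ioo (1/2) 1) := by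
  have hsum : Summable fun j : ℕ => (1 / ((j + 1 : ℕ) : ℝ)) ^ l := by
    simp only [one_div_pow]
    exact (summable_nat_add_iff 1).2 (Real.summable_one_div_nat_pow.2 hl)
  have hbound (j : ℕ) (ν : ℝ) (hν : ν ∈ Set.Ioo (1 / 2 : ℝ) 1) :
      ‖rho ν (j + 1) ^ l‖ ≤ (1 / ((j + 1 : ℕ) : ℝ)) ^ l := by
    rw [norm_pow, Real.norm_eq_abs]
    exact pow_le_pow_left₀ (abs_nonneg _) (abs_rho_succ_le hν j) l
  exact ⟨fun ν hν => hsum.of_norm_bounded fun j => hbound j ν hν,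
    continuousOn_tsum (fun j => (continuousOn_rho_succ j).pow l) hsum hbound⟩
end

section
/- There exists a finite constant K such that for every integer l ≥ 2 and every ν ∈ (1/2, 1), Σ_{j=1}^∞ |ρ_ν(j)|^l ≤ Σ_{j=1}^∞ ρ_ν(j)² ≤ K. -/
/-- Minus the autocorrelation is half the decrement of the increments of `x ↦ x ^ (2ν-1)`. -/
theorem neg_rho_succ (ν : ℝ) (j : ℕ) :
    -rho ν (j + 1) = (1 / 2) * (((j : ℝ) + 1) ^ (2 * ν - 1) - (j : ℝ) ^ (2 * ν - 1)) -
      (1 / 2) * ((((j + 1 : ℕ) : ℝ) + 1) ^ (2 * ν - 1) - ((j + 1 : ℕ) : ℝ) ^ (2 * ν - 1)) := by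
  have h : ((j + 1 : ℕ) : ℝ) - 1 = j := by push_cast; ring
  rw [rho, h]
  push_cast
  ring

theorem rho_succ_nonpos {ν : ℝ} (hν : ν ∈ Set.Icc (1 / 2 : ℝ) 1) (j : ℕ) :
    rho ν (j + 1) ≤ 0 := by
  have hc := Real.concaveOn_rpow (p := 2 * ν - 1) (by linarith [hν.1]) (by linarith [hν.2])
  have h := hc.2 (Set.mem_Ici.2 (by positivity : (0 : ℝ) ≤ j))
    (Set.mem_Ici.2 (by positivity : (0 : ℝ) ≤ j + 2))
    (by norm_num : (0 : ℝ) ≤ 1 / 2) (by norm_num : (0 : ℝ) ≤ 1 / 2) (by norm_num)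
  have hmid : (1 / 2 : ℝ) • (j : ℝ) + (1 / 2 : ℝ) • ((j : ℝ) + 2) = j + 1 := by
    simp only [smul_eq_mul]; ring
  rw [hmid] at h
  simp only [smul_eq_mul] at h
  have hr := neg_rho_succ ν j
  push_cast at hr
  rw [show (j : ℝ) + 1 + 1 = j + 2 by ring] at hr
  linarith

theorem sum_range_abs_rho_succ_le {ν : ℝ} (hν : ν ∈ Set.Ioc (1 / 2 : ℝ) 1) (n : ℕ) :
    ∑ j ∈ Finset.range n, |rho ν (j + 1)| ≤ 1 / 2 := by
  have ha : 0 < 2 * ν - 1 := by linarith [hν.1]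
  simp_rw [fun j => abs_of_nonpos (rho_succ_nonpos ⟨hν.1.le, hν.2⟩ j), neg_rho_succ]
  rw [Finset.sum_range_sub' fun j : ℕ =>
    (1 / 2) * (((j : ℝ) + 1) ^ (2 * ν - 1) - (j : ℝ) ^ (2 * ν - 1))]
  have hmono : (n : ℝ) ^ (2 * ν - 1) ≤ ((n : ℝ) + 1) ^ (2 * ν - 1) :=
    Real.rpow_le_rpow (by positivity) (by linarith) ha.le
  simp only [Nat.cast_zero, zero_add, Real.one_rpow, Real.zero_rpow ha.ne']
  linarith

theorem rho_power_series_uniform_bound :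
    ∃ K : ℝ, ∀ ν ∈ Set.Ioo (1/2 : ℝ) 1,
      (∀ l : ℕ, 2 ≤ l →
        Summable (fun j : ℕ => |rho ν (j+1)| ^ l) ∧
          (∑' j : ℕ, |rho ν (j+1)| ^ l) ≤ ∑' j : ℕ, rho ν (j+1) ^ 2) ∧
        (∑' j : ℕ, rho ν (j+1) ^ 2) ≤ K := by
  refine ⟨1 / 2, fun ν hν => ?_⟩
  have hsum := sum_range_abs_rho_succ_le (Set.Ioo_subset_Ioc_self hν)
  have hle : ∀ j, |rho ν (j + 1)| ≤ 1 := fun j => by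
    have h := Finset.single_le_sum (f := fun i => |rho ν (i + 1)|)
      (fun i _ => abs_nonneg _) (Finset.self_mem_range_succ j)
    linarith [hsum (j + 1)]
  have hs : Summable fun j : ℕ => |rho ν (j + 1)| :=
    summable_of_sum_range_le (fun _ => abs_nonneg _) hsum
  have hpow : ∀ l : ℕ, 2 ≤ l → Summable fun j : ℕ => |rho ν (j + 1)| ^ l := fun l hl =>
    hs.of_nonneg_of_le (fun _ => by positivity)
      fun j => pow_le_of_le_one (abs_nonneg _) (hle j) (by omega)
  simp_rw [← sq_abs (rho ν _)]
  refine ⟨fun l hl => ⟨hpow l hl, (hpow l hl).tsum_le_tsum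
    (fun j => pow_le_pow_of_le_one (abs_nonneg _) (hle j) hl) (hpow 2 le_rfl)⟩, ?_⟩
  exact ((hpow 2 le_rfl).tsum_le_tsum
    (fun j => pow_le_of_le_one (abs_nonneg _) (hle j) two_ne_zero) hs).trans
    (Real.tsum_le_of_sum_range_le (fun _ => abs_nonneg _) hsum)
end

section
/- Let T > 0 and set s* = −max{(η−1)/ρ, 1}. Let a : ℝ → ℝ be measurable and such that M = sup_{s ∈ [s*, T]} |a(s)| < ∞, such that for every u ∈ [0, T] the function s ↦ q(u − s)·a(s) is Lebesgue integrable on (−∞, u), and such that A* = sup_{0 ≤ u ≤ T} ∫_{−∞}^u q(u − s)·|a(s)| ds < ∞. Define A(t) = ∫_{−∞}^t q(t − s)·a(s) ds for t ∈ [0, T]. Then there exists a constant C > 0 such that for every δ ∈ (0, 1) and every integer j ≥ 1 with jδ ≤ T, |A(jδ) − A((j−1)δ)| ≤ C · δ^{min{η, 1}}. -/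
open MeasureTheory

/-- The gamma kernel `q(t) = c t^{η-1} e^{-ρ t}`, using real powers. -/
noncomputable def gammaKernel (c η ρ t : ℝ) : ℝ := c * t ^ (η - 1) * Real.exp (-ρ * t)

/-- The skewness term `A(t) = ∫_{-∞}^t q(t-s) a(s) ds` of a Brownian semistationary process,
with a gamma kernel `q`. -/
noncomputable def skewTerm (c η ρ : ℝ) (a : ℝ → ℝ) (t : ℝ) : ℝ :=
  ∫ s in Set.Iio t, gammaKernel c η ρ (t - s) * a s

theorem Real.abs_exp_sub_one_le_abs_mul_exp_abs (y : ℝ) :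
    |Real.exp y - 1| ≤ |y| * Real.exp |y| := by
  rcases le_total 0 y with hy | hy
  · rw [abs_of_nonneg hy, abs_of_nonneg (by linarith [Real.add_one_le_exp y])]
    have h := mul_le_mul_of_nonneg_left (Real.add_one_le_exp (-y)) (Real.exp_pos y).le
    rw [← Real.exp_add, add_neg_cancel, Real.exp_zero] at h
    linarith
  · rw [abs_of_nonpos hy, abs_of_nonpos (by linarith [Real.exp_le_one_iff.2 hy])]
    nlinarith [Real.add_one_le_exp y, Real.one_le_exp (neg_nonneg.2 hy)]

theorem Real.abs_rpow_add_sub_rpow_le (p : ℝ) {t δ : ℝ} (ht : 1 ≤ t) (hδ : 0 ≤ δ) (hδ1 : δ ≤ 1) :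
    |(t + δ) ^ p - t ^ p| ≤ |p| * Real.exp |p| * δ * t ^ p := by
  have ht0 : 0 < t := by linarith
  have hx0 : 0 ≤ δ / t := by positivity
  have hxδ : δ / t ≤ δ := div_le_self hδ ht
  have hsplit : (t + δ) ^ p - t ^ p = t ^ p * (Real.exp (Real.log (1 + δ / t) * p) - 1) := by
    rw [← Real.rpow_def_of_pos (by positivity), mul_sub, ← Real.mul_rpow ht0.le (by positivity),
      mul_one, mul_add, mul_one, mul_div_cancel₀ _ ht0.ne']
  have hlog0 : 0 ≤ Real.log (1 + δ / t) := Real.log_nonneg (by linarith)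
  have hlog : Real.log (1 + δ / t) ≤ δ := by
    linarith [Real.log_le_sub_one_of_pos (show 0 < 1 + δ / t by positivity)]
  have hy : |Real.log (1 + δ / t) * p| ≤ δ * |p| := by
    rw [abs_mul, abs_of_nonneg hlog0]
    gcongr
  have hy1 : |Real.log (1 + δ / t) * p| ≤ |p| :=
    hy.trans (mul_le_of_le_one_left (abs_nonneg p) hδ1)
  rw [hsplit, abs_mul, abs_of_pos (Real.rpow_pos_of_pos ht0 p)]
  calc t ^ p * |Real.exp (Real.log (1 + δ / t) * p) - 1|
      ≤ t ^ p * (δ * |p| * Real.exp |p|) := by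
        gcongr
        refine (Real.abs_exp_sub_one_le_abs_mul_exp_abs _).trans ?_
        gcongr
    _ = |p| * Real.exp |p| * δ * t ^ p := by ring

theorem gammaKernel_nonneg {c : ℝ} (hc : 0 ≤ c) (η ρ : ℝ) {t : ℝ} (ht : 0 ≤ t) :
    0 ≤ gammaKernel c η ρ t := by
  unfold gammaKernel
  positivity

theorem gammaKernel_le {c ρ t : ℝ} (hc : 0 ≤ c) (η : ℝ) (hρ : 0 ≤ ρ) (ht : 0 ≤ t) :
    gammaKernel c η ρ t ≤ c * t ^ (η - 1) := by
  unfold gammaKernel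
  refine mul_le_of_le_one_right (by positivity) (Real.exp_le_one_iff.2 ?_)
  nlinarith [mul_nonneg hρ ht]

theorem abs_gammaKernel_add_sub_le {c ρ t δ : ℝ} (hc : 0 ≤ c) (η : ℝ) (hρ : 0 ≤ ρ) (ht : 0 ≤ t)
    (hδ : 0 ≤ δ) :
    |gammaKernel c η ρ (t + δ) - gammaKernel c η ρ t| ≤
      c * |(t + δ) ^ (η - 1) - t ^ (η - 1)| * Real.exp (-ρ * t) +
        ρ * δ * gammaKernel c η ρ t := by
  have hexp : Real.exp (-ρ * (t + δ)) = Real.exp (-ρ * t) * Real.exp (-(ρ * δ)) := by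
    rw [← Real.exp_add]; ring_nf
  have hle : Real.exp (-(ρ * δ)) ≤ 1 := Real.exp_le_one_iff.2 (by nlinarith [mul_nonneg hρ hδ])
  have hsplit : gammaKernel c η ρ (t + δ) - gammaKernel c η ρ t =
      c * ((t + δ) ^ (η - 1) - t ^ (η - 1)) * Real.exp (-ρ * t) * Real.exp (-(ρ * δ)) -
        (1 - Real.exp (-(ρ * δ))) * gammaKernel c η ρ t := by
    unfold gammaKernel
    rw [hexp]; ring
  rw [hsplit]
  refine (abs_sub _ _).trans (add_le_add ?_ ?_)
  · rw [abs_mul, abs_mul, abs_mul, abs_of_nonneg hc, Real.abs_exp, Real.abs_exp]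
    exact mul_le_of_le_one_right (by positivity) hle
  · rw [abs_mul, abs_of_nonneg (sub_nonneg.2 hle), abs_of_nonneg (gammaKernel_nonneg hc η ρ ht)]
    refine mul_le_mul_of_nonneg_right ?_ (gammaKernel_nonneg hc η ρ ht)
    linarith [Real.add_one_le_exp (-(ρ * δ))]

theorem intervalIntegrable_add_rpow {p : ℝ} (hp : -1 < p) (δ L : ℝ) :
    IntervalIntegrable (fun t : ℝ => (t + δ) ^ p) volume 0 L := by
  have h := (intervalIntegral.intervalIntegrable_rpow' (a := δ) (b := L + δ) hp).comp_add_right δ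
  simpa using h

theorem integral_abs_rpow_add_sub_rpow_le {η L δ : ℝ} (hη : 0 < η) (hL : 1 ≤ L) (hδ : 0 ≤ δ)
    (hδ1 : δ ≤ 1) :
    ∫ t in (0 : ℝ)..L, |(t + δ) ^ (η - 1) - t ^ (η - 1)| ≤
      (δ ^ η + |η| * Real.exp |η| * δ * L ^ η) / η := by
  have hp : -1 < η - 1 := by linarith
  have hL0 : 0 ≤ L := by linarith
  have hval : ∫ t in (0 : ℝ)..L, ((t + δ) ^ (η - 1) - t ^ (η - 1)) =
      ((L + δ) ^ η - δ ^ η - L ^ η) / η := by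
    rw [intervalIntegral.integral_sub (intervalIntegrable_add_rpow hp δ L)
        (intervalIntegral.intervalIntegrable_rpow' hp),
      intervalIntegral.integral_comp_add_right (fun t : ℝ => t ^ (η - 1)),
      integral_rpow (Or.inl hp), integral_rpow (Or.inl hp), sub_add_cancel, zero_add,
      Real.zero_rpow hη.ne']
    ring
  have hK := abs_le.1 (Real.abs_rpow_add_sub_rpow_le η hL hδ hδ1)
  have hδη : 0 ≤ δ ^ η := Real.rpow_nonneg hδ η
  rcases le_total 1 η with h1 | h1
  · have hcongr : ∫ t in (0 : ℝ)..L, |(t + δ) ^ (η - 1) - t ^ (η - 1)| =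
        ∫ t in (0 : ℝ)..L, ((t + δ) ^ (η - 1) - t ^ (η - 1)) := by
      refine intervalIntegral.integral_congr fun t ht => ?_
      rw [Set.uIcc_of_le hL0] at ht
      exact abs_of_nonneg (sub_nonneg.2
        (Real.rpow_le_rpow ht.1 (by linarith) (by linarith)))
    rw [hcongr, hval]
    gcongr
    linarith [hK.2]
  · have hcongr : ∫ t in (0 : ℝ)..L, |(t + δ) ^ (η - 1) - t ^ (η - 1)| =
        ∫ t in (0 : ℝ)..L, -((t + δ) ^ (η - 1) - t ^ (η - 1)) := by
      refine intervalIntegral.integral_congr_ae (Filter.Eventually.of_forall fun t ht => ?_)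
      rw [Set.uIoc_of_le hL0] at ht
      exact abs_of_nonpos (sub_nonpos.2
        (Real.rpow_le_rpow_of_nonpos ht.1 (by linarith) (by linarith)))
    rw [hcongr, intervalIntegral.integral_neg, hval, ← neg_div]
    gcongr
    have : L ^ η ≤ (L + δ) ^ η := Real.rpow_le_rpow hL0 (by linarith) hη.le
    have : 0 ≤ |η| * Real.exp |η| * δ * L ^ η := by positivity
    linarith

theorem integrableOn_gammaKernel_mul_abs {c η ρ u : ℝ} (hc : 0 ≤ c) {a : ℝ → ℝ}
    (h : IntegrableOn (fun s => gammaKernel c η ρ (u - s) * a s) (Set.Iio u)) :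
    IntegrableOn (fun s => gammaKernel c η ρ (u - s) * |a s|) (Set.Iio u) := by
  refine (integrableOn_congr_fun (fun s hs => ?_) measurableSet_Iio).1 h.abs
  have := gammaKernel_nonneg hc η ρ (sub_nonneg.2 (le_of_lt hs))
  simp only [abs_mul, abs_of_nonneg this]

theorem setIntegral_gammaKernel_mul_abs_nonneg {c : ℝ} (hc : 0 ≤ c) (η ρ u : ℝ) (a : ℝ → ℝ) :
    0 ≤ ∫ s in Set.Iio u, gammaKernel c η ρ (u - s) * |a s| :=
  setIntegral_nonneg measurableSet_Iio fun _ hs =>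
    mul_nonneg (gammaKernel_nonneg hc η ρ (sub_nonneg.2 (le_of_lt hs))) (abs_nonneg _)

/-- The part of the increment coming from the new interval `[u - δ, u)`. -/
theorem abs_setIntegral_Ico_gammaKernel_mul_le {c η ρ u δ M : ℝ} (hc : 0 ≤ c) (hη : 0 < η)
    (hρ : 0 ≤ ρ) (hδ : 0 ≤ δ) {a : ℝ → ℝ} (ha : ∀ s ∈ Set.Ico (u - δ) u, |a s| ≤ M) :
    |∫ s in Set.Ico (u - δ) u, gammaKernel c η ρ (u - s) * a s| ≤ c * M * (δ ^ η / η) := by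
  have hp : -1 < η - 1 := by linarith
  have hle : u - δ ≤ u := by linarith
  have hii : IntervalIntegrable (fun s : ℝ => (u - s) ^ (η - 1)) volume (u - δ) u := by
    have h := (intervalIntegral.intervalIntegrable_rpow' (a := δ) (b := 0) hp).comp_sub_left u
    simpa using h
  have hval : ∫ s in Set.Ico (u - δ) u, c * M * (u - s) ^ (η - 1) = c * M * (δ ^ η / η) := by
    rw [integral_const_mul, integral_Ico_eq_integral_Ioo, ← integral_Ioc_eq_integral_Ioo,
      ← intervalIntegral.integral_of_le hle,
      intervalIntegral.integral_comp_sub_left (fun t : ℝ => t ^ (η - 1)), sub_self,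
      sub_sub_cancel, integral_rpow (Or.inl hp), sub_add_cancel, Real.zero_rpow hη.ne', sub_zero]
  have hint : IntegrableOn (fun s : ℝ => c * M * (u - s) ^ (η - 1)) (Set.Ico (u - δ) u) :=
    ((integrableOn_Ico_iff_integrableOn_Ioo (by simp)).2
      ((integrableOn_Ioc_iff_integrableOn_Ioo (by simp)).1
        ((intervalIntegrable_iff_integrableOn_Ioc_of_le hle).1 hii))).const_mul _
  rw [← hval, ← Real.norm_eq_abs]
  refine norm_integral_le_of_norm_le hint ((ae_restrict_iff' measurableSet_Ico).2
    (Filter.Eventually.of_forall fun s hs => ?_))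
  have hs0 : 0 ≤ u - s := sub_nonneg.2 hs.2.le
  rw [Real.norm_eq_abs, abs_mul, abs_of_nonneg (gammaKernel_nonneg hc η ρ hs0), mul_right_comm]
  exact mul_le_mul (gammaKernel_le hc η hρ hs0) (ha s hs) (abs_nonneg _) (by positivity)

/-- The part of the increment coming from the change of kernel on `(-∞, v)`. -/
theorem abs_setIntegral_gammaKernel_sub_mul_le {c η ρ r v δ M : ℝ} (hc : 0 ≤ c) (hη : 0 < η)
    (hρ : 0 ≤ ρ) (hr : r + 1 ≤ v) (hδ : 0 ≤ δ) (hδ1 : δ ≤ 1) (hM0 : 0 ≤ M) {a : ℝ → ℝ}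
    (ha : ∀ s ∈ Set.Ioo r v, |a s| ≤ M)
    (hint : IntegrableOn (fun s => gammaKernel c η ρ (v - s) * a s) (Set.Iio v)) :
    |∫ s in Set.Iio v,
        (gammaKernel c η ρ (v + δ - s) * a s - gammaKernel c η ρ (v - s) * a s)| ≤
      (ρ + |η - 1| * Real.exp |η - 1|) * δ *
          (∫ s in Set.Iio v, gammaKernel c η ρ (v - s) * |a s|) +
        c * M * ((δ ^ η + |η| * Real.exp |η| * δ * (v - r) ^ η) / η) := by
  set K := |η - 1| * Real.exp |η - 1| with hK
  have hK0 : 0 ≤ K := by positivity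
  have hp : -1 < η - 1 := by linarith
  have hle : r ≤ v := by linarith
  set f : ℝ → ℝ := fun t => |(t + δ) ^ (η - 1) - t ^ (η - 1)| with hf
  have hfi : IntervalIntegrable (fun s => f (v - s)) volume r v := by
    have h := (((intervalIntegrable_add_rpow hp δ (v - r)).sub
      (intervalIntegral.intervalIntegrable_rpow' hp)).abs.comp_sub_left v).symm
    simpa using h
  have hfo : IntegrableOn (fun s => c * M * f (v - s)) (Set.Ioo r v) :=
    ((integrableOn_Ioc_iff_integrableOn_Ioo (by simp)).1
      ((intervalIntegrable_iff_integrableOn_Ioc_of_le hle).1 hfi)).const_mul _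
  have hg1 := (integrableOn_gammaKernel_mul_abs hc hint).const_mul ((ρ + K) * δ)
  have hg2 : IntegrableOn ((Set.Ioo r v).indicator fun s => c * M * f (v - s)) (Set.Iio v) :=
    ((integrable_indicator_iff measurableSet_Ioo).2 hfo).integrableOn
  have hfval : ∫ s in Set.Iio v, (Set.Ioo r v).indicator (fun s => c * M * f (v - s)) s =
      c * M * ∫ t in (0 : ℝ)..(v - r), f t := by
    rw [setIntegral_indicator measurableSet_Ioo,
      Set.inter_eq_right.2 (Set.Ioo_subset_Iio_self : Set.Ioo r v ⊆ Set.Iio v), integral_const_mul,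
      ← integral_Ioc_eq_integral_Ioo, ← intervalIntegral.integral_of_le hle,
      intervalIntegral.integral_comp_sub_left f, sub_self]
  have hbound := norm_integral_le_of_norm_le (hg1.add hg2)
    (f := fun s => gammaKernel c η ρ (v + δ - s) * a s - gammaKernel c η ρ (v - s) * a s)
    ((ae_restrict_iff' measurableSet_Iio).2
      ((volume.ae_ne r).mono fun s hsr (hs : s < v) => ?_))
  · rw [integral_add' hg1 hg2, hfval, integral_const_mul, Real.norm_eq_abs] at hbound
    refine hbound.trans (add_le_add_right (mul_le_mul_of_nonneg_left ?_ (by positivity)) _)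
    exact integral_abs_rpow_add_sub_rpow_le hη (by linarith) hδ hδ1
  · have ht : 0 ≤ v - s := by linarith
    have hq := gammaKernel_nonneg hc η ρ ht
    have hinc := abs_gammaKernel_add_sub_le hc η hρ ht hδ
    rw [← sub_mul, Real.norm_eq_abs, abs_mul, show v + δ - s = v - s + δ by ring, Pi.add_apply]
    rcases lt_or_gt_of_ne hsr with h | h
    · rw [Set.indicator_of_notMem (fun hs' : s ∈ Set.Ioo r v => lt_asymm h hs'.1), add_zero,
        ← mul_assoc]
      refine mul_le_mul_of_nonneg_right (hinc.trans ?_) (abs_nonneg _)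
      have hpow := Real.abs_rpow_add_sub_rpow_le (η - 1) (show 1 ≤ v - s by linarith) hδ hδ1
      have : c * |(v - s + δ) ^ (η - 1) - (v - s) ^ (η - 1)| * Real.exp (-ρ * (v - s)) ≤
          c * (K * δ * (v - s) ^ (η - 1)) * Real.exp (-ρ * (v - s)) := by
        gcongr
      unfold gammaKernel
      linarith
    · rw [Set.indicator_of_mem (show s ∈ Set.Ioo r v from ⟨h, hs⟩)]
      have haM := ha s ⟨h, hs⟩
      have hexp : Real.exp (-ρ * (v - s)) ≤ 1 :=
        Real.exp_le_one_iff.2 (by nlinarith [mul_nonneg hρ ht])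
      calc |gammaKernel c η ρ (v - s + δ) - gammaKernel c η ρ (v - s)| * |a s|
          ≤ (c * f (v - s) + ρ * δ * gammaKernel c η ρ (v - s)) * |a s| := by
            gcongr
            refine hinc.trans (add_le_add_left ?_ _)
            exact mul_le_of_le_one_right (by positivity) hexp
        _ = ρ * δ * (gammaKernel c η ρ (v - s) * |a s|) + c * f (v - s) * |a s| := by ring
        _ ≤ (ρ + K) * δ * (gammaKernel c η ρ (v - s) * |a s|) + c * f (v - s) * M := by
            have : 0 ≤ f (v - s) := abs_nonneg _
            gcongr
            linarith
        _ = _ := by ring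

theorem skewTerm_increment_bound (c η ρ : ℝ) (hc : 0 < c) (hη : 0 < η) (hρ : 0 < ρ)
    (T : ℝ) (hT : 0 < T) (a : ℝ → ℝ) (ha_meas : Measurable a)
    (M : ℝ) (hM : ∀ s ∈ Set.Icc (-(max ((η - 1) / ρ) 1)) T, |a s| ≤ M)
    (hint : ∀ u ∈ Set.Icc (0:ℝ) T,
      IntegrableOn (fun s => gammaKernel c η ρ (u - s) * a s) (Set.Iio u))
    (Astar : ℝ) (hAstar : ∀ u ∈ Set.Icc (0:ℝ) T,
      (∫ s in Set.Iio u, gammaKernel c η ρ (u - s) * |a s|) ≤ Astar) :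
    ∃ C : ℝ, 0 < C ∧ ∀ δ ∈ Set.Ioo (0:ℝ) 1, ∀ j : ℕ, 1 ≤ j → (j:ℝ) * δ ≤ T →
      |skewTerm c η ρ a ((j:ℝ) * δ) - skewTerm c η ρ a (((j:ℝ) - 1) * δ)| ≤
        C * δ ^ min η 1 := by
  set r : ℝ := -(max ((η - 1) / ρ) 1)
  have hr1 : r ≤ -1 := neg_le_neg (le_max_right _ _)
  have hM0 : 0 ≤ M := (abs_nonneg (a 0)).trans (hM 0 ⟨by linarith, hT.le⟩)
  have hA0 : 0 ≤ Astar :=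
    (setIntegral_gammaKernel_mul_abs_nonneg hc.le η ρ 0 a).trans (hAstar 0 ⟨le_rfl, hT.le⟩)
  have hTr : 0 ≤ T - r := by linarith
  refine ⟨c * M * (1 / η) + (ρ + |η - 1| * Real.exp |η - 1|) * Astar +
    c * M * ((1 + |η| * Real.exp |η| * (T - r) ^ η) / η) + 1, by positivity, ?_⟩
  rintro δ ⟨hδ, hδ1⟩ j hj hjT
  have hj1 : (1 : ℝ) ≤ j := by exact_mod_cast hj
  obtain ⟨v, hv⟩ : ∃ v : ℝ, v = ((j : ℝ) - 1) * δ := ⟨_, rfl⟩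
  have hu : (j : ℝ) * δ = v + δ := by rw [hv]; ring
  rw [hu] at hjT ⊢
  rw [← hv]
  have hv0 : 0 ≤ v := hv ▸ mul_nonneg (by linarith) hδ.le
  have hvT : v ≤ T := by linarith
  have hintu := hint (v + δ) ⟨by linarith, hjT⟩
  have hintv := hint v ⟨hv0, hvT⟩
  have hunion : Set.Iio v ∪ Set.Ico v (v + δ) = Set.Iio (v + δ) :=
    Set.Iio_union_Ico_eq_Iio (by linarith)
  have hdecomp : skewTerm c η ρ a (v + δ) - skewTerm c η ρ a v =
      (∫ s in Set.Iio v,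
        (gammaKernel c η ρ (v + δ - s) * a s - gammaKernel c η ρ (v - s) * a s)) +
      ∫ s in Set.Ico v (v + δ), gammaKernel c η ρ (v + δ - s) * a s := by
    have hintu' := hintu
    rw [← hunion] at hintu'
    unfold skewTerm
    rw [integral_sub hintu'.left_of_union hintv, ← hunion,
      setIntegral_union
        ((Set.Iio_disjoint_Ici le_rfl).mono_right Set.Ico_subset_Ici_self)
        measurableSet_Ico hintu'.left_of_union hintu'.right_of_union]
    ring
  have hnew : |∫ s in Set.Ico v (v + δ), gammaKernel c η ρ (v + δ - s) * a s| ≤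
      c * M * (δ ^ η / η) := by
    have h := abs_setIntegral_Ico_gammaKernel_mul_le (u := v + δ) (M := M) (a := a)
      hc.le hη hρ.le hδ.le
      (fun s hs => hM s ⟨by linarith [hs.1], by linarith [hs.2]⟩)
    rwa [add_sub_cancel_right] at h
  have hold := abs_setIntegral_gammaKernel_sub_mul_le (r := r) (v := v) (M := M) (a := a)
    hc.le hη hρ.le (by linarith) hδ.le hδ1.le hM0
    (fun s hs => hM s ⟨hs.1.le, by linarith [hs.2]⟩) hintv
  have hδm : δ ≤ δ ^ min η 1 := by
    simpa using Real.rpow_le_rpow_of_exponent_ge hδ hδ1.le (min_le_right η 1)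
  have hδη : δ ^ η ≤ δ ^ min η 1 :=
    Real.rpow_le_rpow_of_exponent_ge hδ hδ1.le (min_le_left η 1)
  have hvr : (v - r) ^ η ≤ (T - r) ^ η := Real.rpow_le_rpow (by linarith) (by linarith) hη.le
  rw [hdecomp]
  generalize δ ^ min η 1 = D at hδm hδη ⊢
  have hD : 0 ≤ D := hδ.le.trans hδm
  calc _ ≤ _ := abs_add_le _ _
    _ ≤ _ := add_le_add hold hnew
    _ ≤ ((ρ + |η - 1| * Real.exp |η - 1|) * D * Astar +
          c * M * ((D + |η| * Real.exp |η| * D * (T - r) ^ η) / η)) + c * M * (D / η) := by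
        have hvr0 : 0 ≤ (v - r) ^ η := Real.rpow_nonneg (by linarith) η
        have hAv := hAstar v ⟨hv0, hvT⟩
        gcongr
        exact setIntegral_gammaKernel_mul_abs_nonneg hc.le η ρ v a
    _ = (c * M * (1 / η) + (ρ + |η - 1| * Real.exp |η - 1|) * Astar +
          c * M * ((1 + |η| * Real.exp |η| * (T - r) ^ η) / η)) * D := by ring
    _ ≤ _ := mul_le_mul_of_nonneg_right (le_add_of_nonneg_right zero_le_one) hD
end
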